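/- Let m and n ≥ 2 be integers with m ≥ (log n)^2, let Y ⊆ G with |Y| = n, and let 0 < ε < 1/4. Then there exists a family 𝒜 of pairs (A, B) with A ⊆ Y+Y and B ⊆ Y, of size |𝒜| ≤ exp(2^{16}·ε^{−2}·√m·(log n)^{3/2}), such that: (i) for every pair of sets J ⊆ Y and I ⊆ Y+Y with J+J ⊆ I and |I| ≤ m, there is (A, B) ∈ 𝒜 such that A ⊆ I and J ⊆ B; and (ii) for every (A, B) ∈ 𝒜, one has |A| ≤ m and moreover either |B| ≤ m/(log n) or the number of pairs (b₁, b₂) ∈ B × B with b₁ + b₂ ∉ A is at most ε²·|B|². -/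

import Mathlib

open Pointwise

section ContainerAlgorithm

variable {G : Type*} [AddCommGroup G] [DecidableEq G]

/-- The requirements on a single member `(A, B)` of the container family. -/
def IsContainerPair (Y : Finset G) (m : ℕ) (ε : ℝ) (p : Finset G × Finset G) : Prop :=
  (p.1 ⊆ Y + Y ∧ p.2 ⊆ Y) ∧ p.1.card ≤ m ∧
    (((p.2.card : ℝ) ≤ (m : ℝ) / Real.log Y.card) ∨
      ((((p.2 ×ˢ p.2).filter (fun q => q.1 + q.2 ∉ p.1)).card : ℝ) ≤
        ε ^ 2 * (p.2.card : ℝ) ^ 2))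

/-- `I` is a set of at most `m` elements of `Y + Y` containing the sumset of `J ⊆ Y`. -/
def IsAdmissible (Y : Finset G) (m : ℕ) (J I : Finset G) : Prop :=
  J ⊆ Y ∧ I ⊆ Y + Y ∧ J + J ⊆ I ∧ I.card ≤ m

/-- The admissible pairs `(J, I)` satisfying `P` are covered by at most `|Y| ^ φ` containers. -/
def IsCovered (Y : Finset G) (m : ℕ) (ε : ℝ) (P : Finset G → Finset G → Prop) (φ : ℝ) : Prop :=
  ∃ 𝒜 : Finset (Finset G × Finset G), (∀ p ∈ 𝒜, IsContainerPair Y m ε p) ∧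
    (𝒜.card : ℝ) ≤ Real.exp (Real.log Y.card * φ) ∧
    ∀ J I : Finset G, IsAdmissible Y m J I → P J I → ∃ p ∈ 𝒜, p.1 ⊆ I ∧ J ⊆ p.2

variable {Y : Finset G} {m : ℕ} {ε : ℝ} {P Q : Finset G → Finset G → Prop} {φ ψ : ℝ}

theorem IsCovered.mono (h : IsCovered Y m ε P φ)
    (hPQ : ∀ J I, IsAdmissible Y m J I → Q J I → P J I) (hφ : φ ≤ ψ) :
    IsCovered Y m ε Q ψ := by
  obtain ⟨𝒜, h1, h2, h3⟩ := h
  refine ⟨𝒜, h1, h2.trans ?_, fun J I hJI hQ => h3 J I hJI (hPQ J I hJI hQ)⟩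
  have := Real.log_natCast_nonneg Y.card
  gcongr

theorem IsCovered.of_forall_not (h : ∀ J I, IsAdmissible Y m J I → ¬ P J I) :
    IsCovered Y m ε P φ :=
  ⟨∅, by simp, by simpa using (Real.exp_pos _).le, fun J I hJI hP => absurd hP (h J I hJI)⟩

theorem IsCovered.or (hY : 2 ≤ Y.card) (hP : IsCovered Y m ε P φ) (hQ : IsCovered Y m ε Q φ) :
    IsCovered Y m ε (fun J I => P J I ∨ Q J I) (φ + 1) := by
  obtain ⟨𝒜, h1, h2, h3⟩ := hP
  obtain ⟨ℬ, k1, k2, k3⟩ := hQ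
  refine ⟨𝒜 ∪ ℬ, ?_, ?_, ?_⟩
  · intro p hp
    exact (Finset.mem_union.1 hp).elim (h1 p) (k1 p)
  · have hY' : (2 : ℝ) ≤ Y.card := by exact_mod_cast hY
    have hu : ((𝒜 ∪ ℬ).card : ℝ) ≤ 𝒜.card + ℬ.card := by exact_mod_cast Finset.card_union_le _ _
    rw [mul_add, mul_one, Real.exp_add, Real.exp_log (by linarith)]
    nlinarith [Real.exp_pos (Real.log Y.card * φ)]
  · rintro J I hJI (h | h)
    · obtain ⟨p, hp, hp'⟩ := h3 J I hJI h
      exact ⟨p, Finset.mem_union_left _ hp, hp'⟩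
    · obtain ⟨p, hp, hp'⟩ := k3 J I hJI h
      exact ⟨p, Finset.mem_union_right _ hp, hp'⟩

theorem sum_powerset_exp_le {ι : Type*} {Y : Finset ι} (hY : 2 ≤ Y.card) (φ : ℝ) :
    ∑ S ∈ Y.powerset, Real.exp (Real.log Y.card * (φ - 2 * S.card - 1)) ≤
      Real.exp (Real.log Y.card * φ) := by
  have hY' : (2 : ℝ) ≤ Y.card := by exact_mod_cast hY
  set n : ℝ := (Y.card : ℝ) with hn
  have hn0 : 0 < n := by linarith
  have hterm (S : Finset ι) : Real.exp (Real.log n * (φ - 2 * S.card - 1)) =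
      Real.exp (Real.log n * φ) * n⁻¹ * ((n ^ 2)⁻¹) ^ S.card := by
    have hsplit : Real.log n * (φ - 2 * S.card - 1) =
        Real.log n * φ + -Real.log n + S.card * -(2 * Real.log n) := by ring
    rw [hsplit, Real.exp_add, Real.exp_add, Real.exp_nat_mul, Real.exp_neg, Real.exp_neg,
      Real.exp_log hn0, two_mul, Real.exp_add, Real.exp_log hn0, sq]
  have hprod : ∑ S ∈ Y.powerset, ((n ^ 2)⁻¹) ^ S.card = (1 + (n ^ 2)⁻¹) ^ Y.card := by
    have := Finset.prod_one_add (f := fun _ : ι => (n ^ 2)⁻¹) Y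
    simpa using this.symm
  have hle : (1 + (n ^ 2)⁻¹) ^ Y.card ≤ n := by
    calc (1 + (n ^ 2)⁻¹) ^ Y.card ≤ (Real.exp ((n ^ 2)⁻¹)) ^ Y.card := by
          gcongr
          linarith [Real.add_one_le_exp ((n ^ 2)⁻¹)]
      _ = Real.exp n⁻¹ := by
          rw [← Real.exp_nat_mul, ← hn]
          congr 1
          field_simp
      _ ≤ Real.exp (Real.log 2) := by
          have h1 : n⁻¹ ≤ 2⁻¹ := by gcongr
          have h2 := Real.log_two_gt_d9
          gcongr
          norm_num at h1 h2 ⊢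
          linarith
      _ = 2 := Real.exp_log two_pos
      _ ≤ n := hY'
  simp_rw [hterm]
  rw [← Finset.mul_sum, hprod]
  calc _ ≤ Real.exp (Real.log n * φ) * n⁻¹ * n := by gcongr
    _ = _ := by field_simp

theorem IsCovered.branch {Q : Finset G → Finset G → Finset G → Prop} (hY : 2 ≤ Y.card)
    (h : ∀ J I, IsAdmissible Y m J I → P J I → ∃ S ⊆ Y, Q S J I)
    (hQ : ∀ S ⊆ Y, IsCovered Y m ε (Q S) (φ - 2 * S.card - 1)) :
    IsCovered Y m ε P φ := by
  choose! 𝒜 h1 h2 h3 using hQ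
  refine ⟨Y.powerset.biUnion 𝒜, ?_, ?_, ?_⟩
  · intro p hp
    obtain ⟨S, hS, hp⟩ := Finset.mem_biUnion.1 hp
    exact h1 S (Finset.mem_powerset.1 hS) p hp
  · calc ((Y.powerset.biUnion 𝒜).card : ℝ) ≤ ∑ S ∈ Y.powerset, ((𝒜 S).card : ℝ) := by
          exact_mod_cast Finset.card_biUnion_le
      _ ≤ ∑ S ∈ Y.powerset, Real.exp (Real.log Y.card * (φ - 2 * S.card - 1)) :=
          Finset.sum_le_sum fun S hS => h2 S (Finset.mem_powerset.1 hS)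
      _ ≤ _ := sum_powerset_exp_le hY φ
  · intro J I hJI hP
    obtain ⟨S, hS, hQS⟩ := h J I hJI hP
    obtain ⟨p, hp, hp'⟩ := h3 S hS J I hJI hQS
    exact ⟨p, Finset.mem_biUnion.2 ⟨S, Finset.mem_powerset.2 hS, hp⟩, hp'⟩

theorem IsCovered.of_pair {A B : Finset G} (hφ : 0 ≤ φ) (hB : B ⊆ Y)
    (hAB : (B.card : ℝ) ≤ (m : ℝ) / Real.log Y.card ∨
      (((B ×ˢ B).filter (fun q => q.1 + q.2 ∉ A)).card : ℝ) ≤ ε ^ 2 * (B.card : ℝ) ^ 2) :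
    IsCovered Y m ε (fun J I => A ⊆ I ∧ J ⊆ B) φ := by
  by_cases hA : A ⊆ Y + Y ∧ A.card ≤ m
  · refine ⟨{(A, B)}, ?_, ?_, ?_⟩
    · simpa [IsContainerPair] using ⟨⟨hA.1, hB⟩, hA.2, hAB⟩
    · have := Real.log_natCast_nonneg Y.card
      simpa using mul_nonneg this hφ
    · intro J I _ hP
      exact ⟨_, Finset.mem_singleton_self _, hP⟩
  · refine .of_forall_not fun J I hJI hP => hA ⟨hP.1.trans hJI.2.1, ?_⟩
    exact (Finset.card_le_card hP.1).trans hJI.2.2.2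

theorem IsCovered.of_card_le {B : Finset G} (hY : 2 ≤ Y.card) (hφ : (B.card : ℝ) ≤ φ) :
    IsCovered Y m ε (fun J _ => J ⊆ B) φ := by
  classical
  refine ⟨(B.powerset.filter fun J => IsContainerPair Y m ε (J + J, J)).image
    fun J => (J + J, J), ?_, ?_, ?_⟩
  · intro p hp
    obtain ⟨J, hJ, rfl⟩ := Finset.mem_image.1 hp
    exact (Finset.mem_filter.1 hJ).2
  · have hY' : (2 : ℝ) ≤ Y.card := by exact_mod_cast hY
    have hcard : (((B.powerset.filter fun J => IsContainerPair Y m ε (J + J, J)).image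
        fun J => (J + J, J)).card : ℝ) ≤ 2 ^ B.card := by
      exact_mod_cast Finset.card_image_le.trans
        ((Finset.card_filter_le _ _).trans (Finset.card_powerset B).le)
    calc _ ≤ (2 : ℝ) ^ B.card := hcard
      _ ≤ (Y.card : ℝ) ^ B.card := by gcongr
      _ = Real.exp (Real.log Y.card * B.card) := by
          rw [mul_comm, Real.exp_nat_mul, Real.exp_log (by linarith)]
      _ ≤ _ := by
          have := Real.log_natCast_nonneg Y.card
          gcongr
  · intro J I hJI hJB
    refine ⟨(J + J, J), Finset.mem_image_of_mem _ (Finset.mem_filter.2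
      ⟨Finset.mem_powerset.2 hJB, ⟨Finset.add_subset_add hJI.1 hJI.1, hJI.1⟩,
        (Finset.card_le_card hJI.2.2.1).trans hJI.2.2.2, Or.inr ?_⟩), hJI.2.2.1, subset_rfl⟩
    rw [Finset.filter_eq_empty_iff.2]
    · simp only [Finset.card_empty, Nat.cast_zero]
      positivity
    · intro q hq
      rw [Finset.mem_product] at hq
      simpa using Finset.add_mem_add hq.1 hq.2

/-- The elements of `B` whose translate by `b` avoids `A`. -/
def missing (A B : Finset G) (b : G) : Finset G := B.filter fun x => b + x ∉ A

theorem card_missing_le (A B : Finset G) (b : G) : (missing A B b).card ≤ B.card :=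
  Finset.card_filter_le _ _

theorem card_filter_add_notMem (A B : Finset G) :
    ((B ×ˢ B).filter (fun q => q.1 + q.2 ∉ A)).card = ∑ b ∈ B, (missing A B b).card := by
  simp only [missing, Finset.card_filter, Finset.sum_product]

theorem sum_card_missing_comm (A B S : Finset G) :
    ∑ b ∈ B, (missing A S b).card = ∑ u ∈ S, (missing A B u).card := by
  simp only [missing, Finset.card_filter]
  rw [Finset.sum_comm]
  simp only [add_comm]

theorem card_missing_le_add {A A' : Finset G} (hA : A ⊆ A') (B : Finset G) (u : G) :
    (missing A B u).card + A.card ≤ (missing A' B u).card + A'.card := by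
  have hsub : missing A B u ⊆ missing A' B u ∪ (A' \ A).image (fun c => c - u) := by
    intro x hx
    obtain ⟨hxB, hxA⟩ := Finset.mem_filter.1 hx
    by_cases h : u + x ∈ A'
    · exact Finset.mem_union_right _
        (Finset.mem_image.2 ⟨u + x, Finset.mem_sdiff.2 ⟨h, hxA⟩, by abel⟩)
    · exact Finset.mem_union_left _ (Finset.mem_filter.2 ⟨hxB, h⟩)
  have h1 := (Finset.card_le_card hsub).trans (Finset.card_union_le _ _)
  have h2 : ((A' \ A).image (fun c => c - u)).card ≤ (A' \ A).card := Finset.card_image_le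
  have h3 := Finset.card_sdiff_add_card_eq_card hA
  omega

theorem card_filter_ge_of_sum_ge {ι : Type*} {B : Finset ι} {f : ι → ℝ} {M a : ℝ} (hM : 0 < M) (ha : 0 ≤ a)
    (hf : ∀ b ∈ B, f b ≤ M) (hsum : 2 * a * M * B.card ≤ ∑ b ∈ B, f b) :
    a * B.card ≤ (B.filter fun b => a * M ≤ f b).card := by
  have h1 : ∑ b ∈ B.filter (fun b => a * M ≤ f b), f b ≤
      (B.filter fun b => a * M ≤ f b).card * M := by
    rw [← nsmul_eq_mul]
    exact Finset.sum_le_card_nsmul _ _ _ fun b hb => hf b (Finset.mem_filter.1 hb).1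
  have h2 : ∑ b ∈ B.filter (fun b => ¬ a * M ≤ f b), f b ≤ B.card * (a * M) := by
    calc _ ≤ ((B.filter fun b => ¬ a * M ≤ f b).card : ℝ) * (a * M) := by
          rw [← nsmul_eq_mul]
          exact Finset.sum_le_card_nsmul _ _ _ fun b hb =>
            (not_le.1 (Finset.mem_filter.1 hb).2).le
      _ ≤ _ := by
          gcongr
          exact Finset.filter_subset _ _
  rw [← Finset.sum_filter_add_sum_filter_not B (fun b => a * M ≤ f b)] at hsum
  refine le_of_mul_le_mul_right ?_ hM
  linarith

/-- Greedily enlarge `A` by translates of `S` until every element of `J` gains little. -/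
theorem exists_saturating_subset (J S A : Finset G) {c : ℝ} (hc : 0 < c) :
    ∃ T ⊆ J, c * T.card ≤ (A ∪ (T + S)).card - A.card ∧
      ∀ b ∈ J, ((missing (A ∪ (T + S)) S b).card : ℝ) < c := by
  obtain ⟨T, hT, hmax⟩ := Finset.exists_max_image
    (J.powerset.filter fun T => c * T.card ≤ ((A ∪ (T + S)).card : ℝ) - A.card) Finset.card
    ⟨∅, by simp⟩
  obtain ⟨hTJ, hTc⟩ := Finset.mem_filter.1 hT
  rw [Finset.mem_powerset] at hTJ
  refine ⟨T, hTJ, hTc, fun b hb => ?_⟩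
  by_contra! hbc
  have hbT : b ∉ T := by
    intro hbT
    have : missing (A ∪ (T + S)) S b = ∅ :=
      Finset.filter_eq_empty_iff.2 fun x hx => by
        simpa using fun _ => Finset.add_mem_add hbT hx
    rw [this] at hbc
    simp at hbc
    linarith
  have hgain : (A ∪ (T + S)).card + (missing (A ∪ (T + S)) S b).card ≤
      (A ∪ (insert b T + S)).card := by
    rw [← Finset.card_image_of_injective (missing (A ∪ (T + S)) S b) (add_right_injective b),
      ← Finset.card_union_of_disjoint]
    · refine Finset.card_le_card (Finset.union_subset ?_ ?_)
      · exact Finset.union_subset_union_right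
          (Finset.add_subset_add_right (Finset.subset_insert _ _))
      · intro x hx
        obtain ⟨y, hy, rfl⟩ := Finset.mem_image.1 hx
        exact Finset.mem_union_right _
          (Finset.add_mem_add (Finset.mem_insert_self _ _) (Finset.mem_filter.1 hy).1)
    · refine Finset.disjoint_right.2 fun x hx => ?_
      obtain ⟨y, hy, rfl⟩ := Finset.mem_image.1 hx
      exact (Finset.mem_filter.1 hy).2
  have hgain' : ((A ∪ (T + S)).card : ℝ) + (missing (A ∪ (T + S)) S b).card ≤
      (A ∪ (insert b T + S)).card := by exact_mod_cast hgain
  have := hmax (insert b T) (Finset.mem_filter.2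
    ⟨Finset.mem_powerset.2 (Finset.insert_subset hb hTJ), by
      rw [Finset.card_insert_of_notMem hbT]
      push_cast
      linarith⟩)
  rw [Finset.card_insert_of_notMem hbT] at this
  omega

theorem card_filter_missing_lt_le {A A' B S : Finset G} {e : ℝ} (he : 0 ≤ e) (hS : S.Nonempty)
    (hA : A ⊆ A') (hdeg : ∀ u ∈ S, e / 2 * B.card ≤ (missing A B u).card)
    (hgain : (A'.card : ℝ) - A.card ≤ e / 4 * B.card) :
    ((B.filter fun b => ((missing A' S b).card : ℝ) < e / 8 * S.card).card : ℝ) ≤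
      (1 - e / 8) * B.card := by
  have hSpos : (0 : ℝ) < S.card := by exact_mod_cast hS.card_pos
  have hsum : 2 * (e / 8) * S.card * B.card ≤ ∑ b ∈ B, ((missing A' S b).card : ℝ) := by
    have hcomm : ∑ b ∈ B, ((missing A' S b).card : ℝ) = ∑ u ∈ S, ((missing A' B u).card : ℝ) := by
      exact_mod_cast sum_card_missing_comm A' B S
    rw [hcomm]
    have : S.card • (e / 4 * B.card) ≤ ∑ u ∈ S, ((missing A' B u).card : ℝ) := by
      refine Finset.card_nsmul_le_sum _ _ _ fun u hu => ?_
      have h1 : ((missing A B u).card : ℝ) + A.card ≤ (missing A' B u).card + A'.card := by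
        exact_mod_cast card_missing_le_add hA B u
      linarith [hdeg u hu]
    rw [nsmul_eq_mul] at this
    linarith
  have hlarge := card_filter_ge_of_sum_ge (f := fun b => ((missing A' S b).card : ℝ)) hSpos
    (by positivity) (fun b _ => by exact_mod_cast card_missing_le A' S b) hsum
  have hsplit : ((B.filter fun b => e / 8 * S.card ≤ ((missing A' S b).card : ℝ)).card : ℝ) +
      (B.filter fun b => ¬ e / 8 * S.card ≤ ((missing A' S b).card : ℝ)).card = B.card := by
    exact_mod_cast Finset.card_filter_add_card_filter_not _
  simp only [not_le] at hsplit
  linarith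

theorem log_le_log_sub {x y : ℕ} {a : ℝ} (hx : 2 ≤ x) (ha : a ≤ 1 / 2)
    (hxy : (y : ℝ) ≤ (1 - a) * x) : Real.log y ≤ Real.log x - a := by
  have hx' : (2 : ℝ) ≤ x := by exact_mod_cast hx
  rcases Nat.eq_zero_or_pos y with rfl | hy
  · have := Real.log_le_log two_pos hx'
    have := Real.log_two_gt_d9
    norm_num at *
    linarith
  · have hy' : (0 : ℝ) < y := by exact_mod_cast hy
    calc Real.log y ≤ Real.log ((1 - a) * x) := Real.log_le_log hy' hxy
      _ = Real.log (1 - a) + Real.log x := Real.log_mul (by linarith) (by linarith)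
      _ ≤ _ := by linarith [Real.log_le_sub_one_of_pos (show 0 < 1 - a by linarith)]

/-- An upper bound, up to a factor `log |Y|`, for the logarithm of the number of containers
arising from a pair `(A, B)` with `|A| = a` and `|B| = b`. -/
noncomputable def potential (m s L e : ℝ) (a b : ℕ) : ℝ :=
  16 * s / e + 64 * s / e * Real.log b + 64 * s * L / (e * m) * (m - a)

theorem potential_le_of_card_le {m s L e : ℝ} {a b b' : ℕ} (hs : 0 ≤ s) (he : 0 < e)
    (he' : e ≤ 1) (hb : 2 ≤ b) (hb' : (b' : ℝ) ≤ (1 - e / 8) * b) :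
    potential m s L e a b' ≤ potential m s L e a b - 8 * s := by
  have hlog := log_le_log_sub (a := e / 8) hb (by linarith) hb'
  have h : 64 * s / e * Real.log b' ≤ 64 * s / e * (Real.log b - e / 8) := by gcongr
  have h8 : 64 * s / e * (e / 8) = 8 * s := by field_simp; ring
  unfold potential
  linarith

theorem potential_sub_gain {m s L e : ℝ} {a a' b : ℕ} :
    potential m s L e a' b =
      potential m s L e a b - 64 * s * L / (e * m) * ((a' : ℝ) - a) := by
  unfold potential
  ring

theorem potential_le_self {m s L e : ℝ} {a b b' : ℕ} (hs : 0 ≤ s) (he : 0 < e) (hb : b' ≤ b) :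
    potential m s L e a b' ≤ potential m s L e a b := by
  have h : Real.log b' ≤ Real.log b := by
    rcases Nat.eq_zero_or_pos b' with rfl | h
    · simpa using Real.log_natCast_nonneg b
    · have : (0 : ℝ) < b' := by exact_mod_cast h
      gcongr
  unfold potential
  gcongr

theorem le_potential {m s L e : ℝ} {a b : ℕ} (hs : 0 ≤ s) (he : 0 < e) (hL : 0 ≤ L)
    (hm : 0 ≤ m) (ha : (a : ℝ) ≤ m) : 16 * s / e ≤ potential m s L e a b := by
  have h1 := Real.log_natCast_nonneg b
  have h2 : 0 ≤ m - a := by linarith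
  have h3 : 0 ≤ 64 * s / e * Real.log b := by positivity
  have h4 : 0 ≤ 64 * s * L / (e * m) * (m - a) := by positivity
  unfold potential
  linarith

/-- One round of the algorithm in which `S` consists of `s` elements of large degree and `T` of
`t` elements whose translates of `S` have been added to the first component: either the second
component shrinks or the first one grows substantially. -/
theorem potential_round {m s L e : ℝ} {a a' b b' : ℕ} {t : ℝ} (hs : 1 ≤ s) (he : 0 < e)
    (he' : e ≤ 1) (hL : 0 < L) (hm : 0 < m) (hsm : m ≤ s ^ 2 * L) (hb : 2 ≤ b) (ht : 0 ≤ t)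
    (hbm : m / L ≤ b) (hta : e / 8 * s * t ≤ (a' : ℝ) - a) (hbb : b' ≤ b)
    (h : (a' : ℝ) - a ≤ e / 4 * b → (b' : ℝ) ≤ (1 - e / 8) * b) :
    potential m s L e a' b' ≤ potential m s L e a b - 2 * s - 1 - 1 - 2 * t - 1 := by
  have hfac : 8 * t ≤ 64 * s * L / (e * m) * ((a' : ℝ) - a) := by
    calc 8 * t ≤ 8 * t * (s ^ 2 * L / m) :=
          le_mul_of_one_le_right (by positivity) ((one_le_div hm).2 hsm)
      _ = 64 * s * L / (e * m) * (e / 8 * s * t) := by field_simp; ring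
      _ ≤ _ := by gcongr
  rw [potential_sub_gain (a := a)]
  by_cases hgain : (a' : ℝ) - a ≤ e / 4 * b
  · linarith [potential_le_of_card_le (m := m) (L := L) (a := a) (by linarith : 0 ≤ s) he he' hb
      (h hgain)]
  · have h16 : 16 * s ≤ 64 * s * L / (e * m) * ((a' : ℝ) - a) := by
      calc 16 * s = 64 * s * L / (e * m) * (e / 4 * (m / L)) := by field_simp; norm_num
        _ ≤ 64 * s * L / (e * m) * (e / 4 * b) := by gcongr
        _ ≤ _ := by
            have := (not_le.1 hgain).le
            gcongr
    linarith [potential_le_self (m := m) (L := L) (a := a) (by linarith : 0 ≤ s) he hbb]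

theorem isCovered_of_subset {s : ℕ} (hY : 2 ≤ Y.card) (hε0 : 0 < ε) (hε : ε ≤ 1) (hs : 1 ≤ s)
    (hm : 0 < m) (hsm : (m : ℝ) ≤ s ^ 2 * Real.log Y.card) (N : ℕ) (A B : Finset G) (hB : B ⊆ Y)
    (hN : B.card + (m - A.card) ≤ N) :
    IsCovered Y m ε (fun J I => A ⊆ I ∧ J ⊆ B)
      (potential m s (Real.log Y.card) (ε ^ 2) A.card B.card) := by
  have hL : 0 < Real.log Y.card := Real.log_pos (by exact_mod_cast hY)
  have hs' : (1 : ℝ) ≤ s := by exact_mod_cast hs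
  have hm' : (0 : ℝ) < m := by exact_mod_cast hm
  have he : 0 < ε ^ 2 := by positivity
  have he' : ε ^ 2 ≤ 1 := pow_le_one₀ hε0.le hε
  generalize hedef : ε ^ 2 = e at he he' ⊢
  induction N using Nat.strong_induction_on generalizing A B with
  | _ N ih =>
  rcases lt_or_ge m A.card with hA | hA
  · exact .of_forall_not fun J I hJI hP =>
      absurd ((Finset.card_le_card hP.1).trans hJI.2.2.2) (not_le.2 hA)
  have hpot : 16 * (s : ℝ) / e ≤ potential m s (Real.log Y.card) e A.card B.card :=
    le_potential (by linarith) he hL.le hm'.le (by exact_mod_cast hA)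
  have hpot0 : 0 ≤ 16 * (s : ℝ) / e := by positivity
  rcases le_or_gt (B.card : ℝ) (16 * s / e) with hBs | hBs
  · exact (IsCovered.of_card_le hY (hBs.trans hpot)).mono (fun _ _ _ h => h.2) le_rfl
  by_cases hdone : (B.card : ℝ) ≤ (m : ℝ) / Real.log Y.card ∨
      (((B ×ˢ B).filter (fun q => q.1 + q.2 ∉ A)).card : ℝ) ≤ ε ^ 2 * (B.card : ℝ) ^ 2
  · exact IsCovered.of_pair (hpot0.trans hpot) hB hdone
  obtain ⟨hBm, hpairs⟩ := not_or.1 hdone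
  rw [not_le] at hBm hpairs
  have hBs' : 16 * (s : ℝ) < e * B.card := by
    rwa [div_lt_iff₀ he, mul_comm _ e] at hBs
  have hB2 : 2 ≤ B.card := by
    have : (2 : ℝ) ≤ B.card := by nlinarith
    exact_mod_cast this
  have hBpos : (0 : ℝ) < B.card := by exact_mod_cast (by omega : 0 < B.card)
  -- the elements of large degree
  set H := B.filter fun b => e / 2 * B.card ≤ ((missing A B b).card : ℝ)
  have hHcard : e / 2 * B.card ≤ H.card := by
    refine card_filter_ge_of_sum_ge (f := fun b => ((missing A B b).card : ℝ)) hBpos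
      (by positivity) (fun b _ => by exact_mod_cast card_missing_le A B b) ?_
    rw [card_filter_add_notMem, hedef] at hpairs
    push_cast at hpairs
    linarith
  have hfew : IsCovered Y m ε (fun J I => A ⊆ I ∧ J ⊆ B ∧ (J ∩ H).card < s)
      (potential m s (Real.log Y.card) e A.card B.card - 1) := by
    refine IsCovered.branch
      (Q := fun S J I => S.card < s ∧ S ⊆ H ∧ A ⊆ I ∧ J ⊆ B \ (H \ S)) hY ?_ ?_
    · rintro J I hJI ⟨hAI, hJB, hJH⟩
      refine ⟨J ∩ H, Finset.inter_subset_left.trans hJI.1, hJH, Finset.inter_subset_right,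
        hAI, fun x hx => ?_⟩
      simp [hJB hx, hx]
    · intro S _
      by_cases hS : S.card < s ∧ S ⊆ H
      swap
      · exact .of_forall_not fun J I _ h => hS ⟨h.1, h.2.1⟩
      have hScard : (S.card : ℝ) < s := by exact_mod_cast hS.1
      have hcard : ((B \ (H \ S)).card : ℝ) ≤ (1 - e / 8) * B.card := by
        have h1 := Finset.card_sdiff_add_card_eq_card
          (Finset.sdiff_subset.trans (Finset.filter_subset _ _) : H \ S ⊆ B)
        have h2 := Finset.card_sdiff_add_card_eq_card hS.2
        have h1' : ((B \ (H \ S)).card : ℝ) + (H \ S).card = B.card := by exact_mod_cast h1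
        have h2' : ((H \ S).card : ℝ) + S.card = H.card := by exact_mod_cast h2
        linarith
      have hlt : (B \ (H \ S)).card < B.card := by
        have : ((B \ (H \ S)).card : ℝ) < B.card := by nlinarith
        exact_mod_cast this
      refine (ih _ ?_ A (B \ (H \ S)) (Finset.sdiff_subset.trans hB) le_rfl).mono
        (fun J I _ h => h.2.2) ?_
      · omega
      · linarith [potential_le_of_card_le (m := m) (L := Real.log Y.card) (a := A.card)
          (by linarith : (0 : ℝ) ≤ s) he he' hB2 hcard]
  have hmany : IsCovered Y m ε (fun J I => A ⊆ I ∧ J ⊆ B ∧ s ≤ (J ∩ H).card)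
      (potential m s (Real.log Y.card) e A.card B.card - 1) := by
    refine IsCovered.branch (Q := fun S J I => S.card = s ∧ S ⊆ H ∧ S ⊆ J ∧ A ⊆ I ∧ J ⊆ B)
      hY ?_ ?_
    · rintro J I hJI ⟨hAI, hJB, hJH⟩
      obtain ⟨S, hS, hSs⟩ := Finset.exists_subset_card_eq hJH
      rw [Finset.subset_inter_iff] at hS
      exact ⟨S, hS.1.trans hJI.1, hSs, hS.2, hS.1, hAI, hJB⟩
    intro S _
    by_cases hS : S.card = s ∧ S ⊆ H
    swap
    · exact .of_forall_not fun J I _ h => hS ⟨h.1, h.2.1⟩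
    obtain ⟨hSs, hSH⟩ := hS
    have hSne : S.Nonempty := Finset.card_pos.1 (by omega)
    rw [hSs]
    refine IsCovered.branch (Q := fun T J I =>
      e / 8 * s * T.card ≤ (A ∪ (T + S)).card - A.card ∧ A ∪ (T + S) ⊆ I ∧
        J ⊆ B.filter fun b => ((missing (A ∪ (T + S)) S b).card : ℝ) < e / 8 * S.card) hY ?_ ?_
    · rintro J I hJI ⟨-, -, hSJ, hAI, hJB⟩
      obtain ⟨T, hTJ, hT, hlow⟩ := exists_saturating_subset J S A
        (c := e / 8 * s) (by positivity)
      refine ⟨T, hTJ.trans hJI.1, hT, Finset.union_subset hAI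
        ((Finset.add_subset_add hTJ hSJ).trans hJI.2.2.1), fun b hb => ?_⟩
      exact Finset.mem_filter.2 ⟨hJB hb, by rw [hSs]; exact hlow b hb⟩
    intro T _
    by_cases hT : e / 8 * s * T.card ≤ ((A ∪ (T + S)).card : ℝ) - A.card
    swap
    · exact .of_forall_not fun J I _ h => hT h.1
    set A' := A ∪ (T + S)
    set B' := B.filter fun b => ((missing A' S b).card : ℝ) < e / 8 * S.card
    have hAA' : A ⊆ A' := Finset.subset_union_left
    have hBB' : B'.card ≤ B.card := Finset.card_filter_le _ _
    have hshrink : (A'.card : ℝ) - A.card ≤ e / 4 * B.card →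
        (B'.card : ℝ) ≤ (1 - e / 8) * B.card :=
      card_filter_missing_lt_le he.le hSne hAA' fun u hu => (Finset.mem_filter.1 (hSH hu)).2
    rcases lt_or_ge m A'.card with hA' | hA'
    · exact .of_forall_not fun J I hJI h =>
        absurd ((Finset.card_le_card h.2.1).trans hJI.2.2.2) (not_le.2 hA')
    refine (ih _ ?_ A' B' ((Finset.filter_subset _ _).trans hB) le_rfl).mono
      (fun J I _ h => h.2) ?_
    · have hcard := Finset.card_le_card hAA'
      by_cases hgain : (A'.card : ℝ) - A.card ≤ e / 4 * B.card
      · have : (B'.card : ℝ) < B.card := by nlinarith [hshrink hgain]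
        have : B'.card < B.card := by exact_mod_cast this
        omega
      · have : (A.card : ℝ) < A'.card := by nlinarith
        have : A.card < A'.card := by exact_mod_cast this
        omega
    · have := potential_round hs' he he' hL hm' hsm hB2 (Nat.cast_nonneg T.card) hBm.le hT hBB'
        hshrink
      linarith
  refine (hfew.or hY hmany).mono (fun J I _ h => ?_) (by linarith)
  rcases lt_or_ge (J ∩ H).card s with hJ | hJ
  · exact Or.inl ⟨h.1, h.2, hJ⟩
  · exact Or.inr ⟨h.1, h.2, hJ⟩

end ContainerAlgorithm

theorem potential_zero_mul_log_le {m s L e : ℝ} {n : ℕ} (hL : Real.log n = L)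
    (hL2 : 1 / 2 ≤ L) (hm : L ^ 2 ≤ m) (hs : s ≤ √(m / L) + 1) (hs0 : 0 ≤ s) (he : 0 < e) :
    L * potential m s L e 0 n ≤ 2 ^ 16 * e⁻¹ * √m * L ^ ((3 : ℝ) / 2) := by
  have hL0 : 0 < L := by linarith
  have hm0 : 0 < m := by nlinarith
  have hr : 1 ≤ 2 * √(m / L) := by
    have : 1 / 2 ≤ √(m / L) := by
      apply Real.le_sqrt_of_sq_le
      rw [le_div_iff₀ hL0]
      nlinarith
    linarith
  have hpot : potential m s L e 0 n = e⁻¹ * (16 * s + 128 * (s * L)) := by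
    unfold potential
    rw [hL]
    field_simp
    push_cast
    ring
  have hpow : √m * L ^ ((3 : ℝ) / 2) = √(m / L) * L ^ 2 := by
    have h32 : L ^ ((3 : ℝ) / 2) = L * √L := by
      rw [Real.sqrt_eq_rpow, show (3 : ℝ) / 2 = 1 + 1 / 2 by norm_num,
        Real.rpow_add hL0, Real.rpow_one]
    rw [h32, Real.sqrt_div' _ hL0.le]
    have hsq := Real.mul_self_sqrt hL0.le
    have : √L ≠ 0 := by positivity
    field_simp
    nlinarith
  calc L * potential m s L e 0 n = e⁻¹ * ((16 * s + 128 * (s * L)) * L) := by rw [hpot]; ring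
    _ ≤ e⁻¹ * (480 * √(m / L) * L ^ 2) := by
        refine mul_le_mul_of_nonneg_left ?_ (by positivity)
        have h1 : s ≤ 3 * √(m / L) := by linarith
        have h2 : s * L ≤ 3 * √(m / L) * L := by gcongr
        have h3 : s ≤ 2 * (s * L) := by nlinarith
        calc (16 * s + 128 * (s * L)) * L ≤ (480 * √(m / L) * L) * L :=
              mul_le_mul_of_nonneg_right (by linarith) hL0.le
          _ = _ := by ring
    _ ≤ e⁻¹ * (2 ^ 16 * √(m / L) * L ^ 2) := by gcongr; norm_num
    _ = 2 ^ 16 * e⁻¹ * (√(m / L) * L ^ 2) := by ring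
    _ = _ := by rw [← hpow]; ring

/-- (Container theorem.) Let `m` and `n ≥ 2` be integers with
`m ≥ (log n)^2`, `Y ⊆ G` with `|Y| = n`, and `0 < ε < 1/4`. There is a family `𝒜` of
pairs `(A, B)` with `A ⊆ Y+Y`, `B ⊆ Y`, of size at most
`exp(2^16·ε⁻²·√m·(log n)^(3/2))`, such that (i) for every `J ⊆ Y` and `I ⊆ Y+Y` with
`J+J ⊆ I` and `|I| ≤ m` there is `(A,B) ∈ 𝒜` with `A ⊆ I` and `J ⊆ B`, and (ii) every
`(A,B) ∈ 𝒜` has `|A| ≤ m` and either `|B| ≤ m/log n` or at most `ε²|B|²` pairs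
`(b₁,b₂) ∈ B×B` with `b₁+b₂ ∉ A`. -/
theorem container_theorem_for_small_doubling
    {G : Type*} [AddCommGroup G] [DecidableEq G]
    (m n : ℕ) (hn : 2 ≤ n) (hm : (Real.log n) ^ 2 ≤ (m : ℝ))
    (Y : Finset G) (hY : Y.card = n)
    (ε : ℝ) (hε0 : 0 < ε) (hε : ε < 1 / 4) :
    ∃ 𝒜 : Finset (Finset G × Finset G),
      (∀ p ∈ 𝒜, p.1 ⊆ Y + Y ∧ p.2 ⊆ Y) ∧
      ((𝒜.card : ℝ) ≤ Real.exp (2 ^ 16 * ε⁻¹ ^ 2 * Real.sqrt m * (Real.log n) ^ ((3 : ℝ) / 2))) ∧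
      (∀ J I : Finset G, J ⊆ Y → I ⊆ Y + Y → J + J ⊆ I → I.card ≤ m →
        ∃ p ∈ 𝒜, p.1 ⊆ I ∧ J ⊆ p.2) ∧
      (∀ p ∈ 𝒜, p.1.card ≤ m ∧
        (((p.2.card : ℝ) ≤ (m : ℝ) / Real.log n) ∨
          ((((p.2 ×ˢ p.2).filter (fun q => q.1 + q.2 ∉ p.1)).card : ℝ) ≤
            ε ^ 2 * (p.2.card : ℝ) ^ 2))) := by
  subst hY
  have hL2 : 1 / 2 ≤ Real.log Y.card := by
    have h1 := Real.log_two_gt_d9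
    have h2 : Real.log 2 ≤ Real.log Y.card :=
      Real.log_le_log two_pos (by exact_mod_cast hn)
    linarith
  have hL : 0 < Real.log Y.card := by linarith
  have hm0 : (0 : ℝ) < m := lt_of_lt_of_le (by positivity) hm
  have hr : 0 < √(m / Real.log Y.card) := by positivity
  have hsm : (m : ℝ) ≤ (⌈√(m / Real.log Y.card)⌉₊ : ℝ) ^ 2 * Real.log Y.card := by
    rw [← div_le_iff₀ hL]
    exact (Real.sqrt_le_left (by positivity)).1 (Nat.le_ceil _)
  obtain ⟨𝒜, h1, h2, h3⟩ := isCovered_of_subset hn hε0 (by linarith) (Nat.ceil_pos.2 hr)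
    (by exact_mod_cast hm0) hsm _ ∅ Y subset_rfl le_rfl
  refine ⟨𝒜, fun p hp => (h1 p hp).1, h2.trans (Real.exp_le_exp.2 ?_), ?_,
    fun p hp => (h1 p hp).2⟩
  · rw [Finset.card_empty, inv_pow]
    exact potential_zero_mul_log_le rfl hL2 hm (Nat.ceil_lt_add_one hr.le).le (by positivity)
      (by positivity)
  · intro J I hJ hI hJI hIm
    exact h3 J I ⟨hJ, hI, hJI, hIm⟩ ⟨Finset.empty_subset _, hJ⟩
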